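/- Let λ ∈ ℕ, let l_j, m_j ∈ ℕ for j = 1,…,n−1, let η ∈ C₀^∞(ℝⁿ), and set B_λ = {j ∈ {1,…,n−1} : l_jλ − m_j + 1 ∈ ℕ}. Define g_λ^±(s) = ∫_{ℝ₊ⁿ} y_n^s (∏_{j∈B_λ} y_j^{l_j s + m_j − 1}) η(y₁,…,y_{n−1}, ±y_n) dy. Then g_λ^± extend to ℂ as meromorphic functions having at s = −λ poles of order at most card(B_λ) + 1, and the coefficients b_λ^± of (s+λ)^{−card(B_λ)−1} in the Laurent expansions of g_λ^± at s = −λ satisfy b_λ^+ = (−1)^{λ−1} b_λ^−. In fact b_λ^± = (±1)^{λ−1} C_λ, where C_λ = (1/(λ−1)!) ∏_{j∈B_λ} (l_j ∏_{ν=1}^{k_j−1}(l_jλ − m_j + 1 − ν))^{−1} times ∂^{α−1}η(0) if B_λ = {1,…,n−1}, and otherwise times ∫_{ℝ₊^{n−card(B_λ)−1}} (∂^{α−1}η)(T_{B_λ∪{n}}(y)) ∏_{j∉B_λ∪{n}} dy_j; here k_j = l_jλ − m_j + 1 for j ∈ B_λ, and α ∈ ℕⁿ has α_j = k_j for j ∈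 B_λ, α_n = λ, and α_j = 1 otherwise. -/

import Mathlib

open scoped BigOperators Topology
open Filter MeasureTheory Set

namespace KN

variable {n : ℕ}

/-- The standard inner product on `ℝⁿ`. -/
def dot (a x : Fin n → ℝ) : ℝ := ∑ i, a i * x i

/-- The hyperplane `H(a,l) = {x | ⟨a,x⟩ = l}`. -/
def Hplane (a : Fin n → ℝ) (l : ℝ) : Set (Fin n → ℝ) := {x | dot a x = l}

/-- The closed half-space `H⁺(a,l) = {x | ⟨a,x⟩ ≥ l}`. -/
def Hhalf (a : Fin n → ℝ) (l : ℝ) : Set (Fin n → ℝ) := {x | l ≤ dot a x}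

/-- View an integer vector as a real vector. -/
def intPt (a : Fin n → ℤ) : Fin n → ℝ := fun i => (a i : ℝ)

/-- View a vector of naturals as a real vector. -/
def natPt (a : Fin n → ℕ) : Fin n → ℝ := fun i => (a i : ℝ)

/-- The nonnegative octant `ℝ₊ⁿ`. -/
def octant (n : ℕ) : Set (Fin n → ℝ) := {x | ∀ i, 0 ≤ x i}

/-- A (convex rational) polyhedron: a finite intersection of closed half-spaces with
integral data. -/
def IsPolyhedron (P : Set (Fin n → ℝ)) : Prop :=
  ∃ (N : ℕ) (a : Fin N → Fin n → ℤ) (l : Fin N → ℤ),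
    P = ⋂ j, Hhalf (intPt (a j)) ((l j : ℝ))

/-- `(a,l) ∈ ℤⁿ × ℤ` is valid for `P` if `P ⊆ H⁺(a,l)`. -/
def ValidPair (P : Set (Fin n → ℝ)) (a : Fin n → ℤ) (l : ℤ) : Prop :=
  P ⊆ Hhalf (intPt a) (l : ℝ)

/-- A face of a polyhedron `P`: a set of the form `P ∩ H(a,l)` with `(a,l)` valid for `P`. -/
def IsFaceOf (P F : Set (Fin n → ℝ)) : Prop :=
  ∃ (a : Fin n → ℤ) (l : ℤ), ValidPair P a l ∧ F = P ∩ Hplane (intPt a) (l : ℝ)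

/-- Dimension of a subset of `ℝⁿ`: the dimension of its affine hull. -/
noncomputable def setDim (s : Set (Fin n → ℝ)) : ℕ :=
  Module.finrank ℝ (affineSpan ℝ s).direction

/-- First-order partial derivative in the `i`-th coordinate direction. -/
noncomputable def pderiv1 (i : Fin n) (f : (Fin n → ℝ) → ℝ) : (Fin n → ℝ) → ℝ :=
  fun x => fderiv ℝ f x (Pi.single i 1)

/-- Iterated partial derivative `∂^α` for a multi-index `α ∈ ℤ₊ⁿ`. -/
noncomputable def mderiv (α : Fin n → ℕ) (f : (Fin n → ℝ) → ℝ) : (Fin n → ℝ) → ℝ :=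
  (List.finRange n).foldr (fun i g => (pderiv1 i)^[α i] g) f

/-- Taylor coefficient `c_α = ∂^α f(0)/α!`. -/
noncomputable def taylorCoeff (f : (Fin n → ℝ) → ℝ) (α : Fin n → ℕ) : ℝ :=
  mderiv α f 0 / ((∏ i, Nat.factorial (α i) : ℕ) : ℝ)

/-- The Newton polyhedron `Γ₊(f)`: the convex hull of `⋃ {α + ℝ₊ⁿ : c_α ≠ 0}`. -/
def NewtonPolyhedron (f : (Fin n → ℝ) → ℝ) : Set (Fin n → ℝ) :=
  convexHull ℝ {x | ∃ α : Fin n → ℕ, taylorCoeff f α ≠ 0 ∧ ∀ i, (α i : ℝ) ≤ x i}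

/-- The pair `(a,l) ∈ ℤ₊ⁿ × ℤ₊` is valid for `P` and defines the face `γ = P ∩ H(a,l)`. -/
def DefinesFace (P : Set (Fin n → ℝ)) (a : Fin n → ℕ) (l : ℕ) (γ : Set (Fin n → ℝ)) : Prop :=
  P ⊆ Hhalf (natPt a) (l : ℝ) ∧ γ = P ∩ Hplane (natPt a) (l : ℝ)

/-- The anisotropic dilation `x ↦ (t^{a₁}x₁, …, t^{aₙ}xₙ)`. -/
def scaleAction (a : Fin n → ℕ) (t : ℝ) (x : Fin n → ℝ) : Fin n → ℝ :=
  fun i => t ^ (a i) * x i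

/-- `f` admits the `γ`-part on `U` (w.r.t. the polyhedron `P`): for every `x ∈ U` the limit
`lim_{t→0⁺} f(t^{a₁}x₁,…,t^{aₙ}xₙ)/t^l` exists for all valid pairs `(a,l) ∈ ℤ₊ⁿ×ℤ₊`
defining `γ`. -/
def AdmitsGammaPartOn (f : (Fin n → ℝ) → ℝ) (U P γ : Set (Fin n → ℝ)) : Prop :=
  ∀ x ∈ U, ∀ (a : Fin n → ℕ) (l : ℕ), DefinesFace P a l γ →
    ∃ c : ℝ, Filter.Tendsto (fun t : ℝ => f (scaleAction a t x) / t ^ l) (𝓝[>] (0:ℝ)) (𝓝 c)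

/-- Membership in the class `Ê[P](U)`. -/
def MemEhatP (P U : Set (Fin n → ℝ)) (f : (Fin n → ℝ) → ℝ) : Prop :=
  ContDiffOn ℝ (⊤ : ℕ∞) f U ∧ NewtonPolyhedron f ⊆ P ∧
    ∀ γ, IsFaceOf P γ → AdmitsGammaPartOn f U P γ

/-- Membership in the class `Ê(U) = {f : f ∈ Ê[Γ₊(f)](U)}`, where `Ê[∅](U) = {0}`. -/
def MemEhat (U : Set (Fin n → ℝ)) (f : (Fin n → ℝ) → ℝ) : Prop :=
  (NewtonPolyhedron f = ∅ ∧ ∀ x ∈ U, f x = 0) ∨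
  (NewtonPolyhedron f ≠ ∅ ∧ MemEhatP (NewtonPolyhedron f) U f)

/-- The polynomial `γ`-part `Σ_{α ∈ γ ∩ ℤ₊ⁿ} c_α x^α`. -/
noncomputable def gammaPartPoly (f : (Fin n → ℝ) → ℝ) (γ : Set (Fin n → ℝ))
    (x : Fin n → ℝ) : ℝ :=
  ∑' α : {α : Fin n → ℕ // natPt α ∈ γ}, taylorCoeff f α.1 * ∏ i, x i ^ (α.1 i)

/-- `V(γ) = {k : γ + ℝ₊ e_k ⊆ γ}`. -/
def Vset (γ : Set (Fin n → ℝ)) : Set (Fin n) :=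
  {k | ∀ x ∈ γ, ∀ r : ℝ, 0 ≤ r → x + r • (Pi.single k (1:ℝ) : Fin n → ℝ) ∈ γ}

/-- `W(γ) = {1,…,n} \ V(γ)`. -/
def Wset (γ : Set (Fin n → ℝ)) : Set (Fin n) := (Vset γ)ᶜ

open Classical in
/-- `T_I` replaces the coordinates indexed by `I` with `0`. -/
noncomputable def TI (I : Set (Fin n)) (x : Fin n → ℝ) : Fin n → ℝ :=
  fun i => if i ∈ I then 0 else x i

open Classical in
/-- `T_I^r` replaces the coordinates indexed by `I` with `r`. -/
noncomputable def TIr (I : Set (Fin n)) (r : ℝ) (x : Fin n → ℝ) : Fin n → ℝ :=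
  fun i => if i ∈ I then r else x i

/-- The canonical `γ`-part function
`f_γ(x) = Σ_{α ∈ γ_V} (1/α!) (∂^α f)(T_{W(γ)}(x)) x^α`, with `γ_V = T_{V(γ)}(γ) ∩ ℤ₊ⁿ`. -/
noncomputable def gammaFn (f : (Fin n → ℝ) → ℝ) (γ : Set (Fin n → ℝ)) (x : Fin n → ℝ) : ℝ :=
  ∑' α : {α : Fin n → ℕ // natPt α ∈ TI (Vset γ) '' γ},
    mderiv α.1 f (TI (Wset γ) x) * (∏ i, x i ^ (α.1 i)) /
      ((∏ i, Nat.factorial (α.1 i) : ℕ) : ℝ)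

/-- `f` is nondegenerate over `ℝ` w.r.t. its Newton polyhedron: for every nonempty compact
face `γ` of `Γ₊(f)` the gradient of the polynomial `f_γ` does not vanish on
`U ∩ (ℝ \ {0})ⁿ`. -/
def Nondegenerate (f : (Fin n → ℝ) → ℝ) (U : Set (Fin n → ℝ)) : Prop :=
  ∀ γ, IsFaceOf (NewtonPolyhedron f) γ → γ.Nonempty → IsCompact γ →
    ∀ x ∈ U, (∀ i, x i ≠ 0) → fderiv ℝ (gammaPartPoly f γ) x ≠ 0

/-- Condition (C): `f ∈ Ê(U)` and `f` is nondegenerate over `ℝ` w.r.t. `Γ₊(f)`. -/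
def ConditionC (U : Set (Fin n → ℝ)) (f : (Fin n → ℝ) → ℝ) : Prop :=
  MemEhat U f ∧ Nondegenerate f U

/-- The Newton distance `d(f)`: the coordinate of the point where the diagonal meets
the boundary of `Γ₊(f)`. -/
noncomputable def newtonDist (f : (Fin n → ℝ) → ℝ) : ℝ :=
  sInf {t : ℝ | (fun _ : Fin n => t) ∈ NewtonPolyhedron f}

/-- `τ` is the principal face of `Γ₊(f)`: its relative interior contains
`q_* = (d(f),…,d(f))`. -/
def IsPrincipalFace (f : (Fin n → ℝ) → ℝ) (τ : Set (Fin n → ℝ)) : Prop :=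
  IsFaceOf (NewtonPolyhedron f) τ ∧
    (fun _ : Fin n => newtonDist f) ∈ intrinsicInterior ℝ τ

/-- The oscillatory integral `I(t;φ) = ∫ e^{itf(x)} φ(x) dx`. -/
noncomputable def oscInt (f : (Fin n → ℝ) → ℝ) (φ : (Fin n → ℝ) → ℂ) (t : ℝ) : ℂ :=
  ∫ x : Fin n → ℝ, Complex.exp (Complex.I * t * f x) * φ x

/-- `Z₊(s;φ) = ∫ f(x)₊^s φ(x) dx`. -/
noncomputable def zetaPlus (f : (Fin n → ℝ) → ℝ) (φ : (Fin n → ℝ) → ℂ) (s : ℂ) : ℂ :=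
  ∫ x : Fin n → ℝ, ((max (f x) 0 : ℝ) : ℂ) ^ s * φ x

/-- `Z₋(s;φ) = ∫ f(x)₋^s φ(x) dx`. -/
noncomputable def zetaMinus (f : (Fin n → ℝ) → ℝ) (φ : (Fin n → ℝ) → ℂ) (s : ℂ) : ℂ :=
  ∫ x : Fin n → ℝ, ((max (-f x) 0 : ℝ) : ℂ) ^ s * φ x

/-- The local zeta function `Z(s;φ) = ∫ |f(x)|^s φ(x) dx`. -/
noncomputable def zetaAbs (f : (Fin n → ℝ) → ℝ) (φ : (Fin n → ℝ) → ℂ) (s : ℂ) : ℂ :=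
  ∫ x : Fin n → ℝ, ((|f x| : ℝ) : ℂ) ^ s * φ x

/-- An amplitude: a `C^∞` function with compact support contained in `U ∩ V`. -/
def IsAmplitude (U V : Set (Fin n → ℝ)) (φ : (Fin n → ℝ) → ℂ) : Prop :=
  ContDiff ℝ (⊤ : ℕ∞) φ ∧ HasCompactSupport φ ∧ tsupport φ ⊆ U ∩ V

/-- Partial sum `Σ_{α ∈ E, α ≥ -M} Σ_{k=1}^n C_{αk} t^α (log t)^{k-1}`. -/
noncomputable def partialSum (n : ℕ) (E : Set ℝ) (C : ℝ → ℕ → ℂ) (M t : ℝ) : ℂ :=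
  ∑ᶠ α ∈ {β ∈ E | -M ≤ β}, ∑ k ∈ Finset.Icc 1 n,
    C α k * ((t ^ α : ℝ) : ℂ) * (((Real.log t) ^ (k - 1) : ℝ) : ℂ)

/-- `g(t)` admits the asymptotic expansion `Σ_{α ∈ E} Σ_{k=1}^n C_{αk} t^α (log t)^{k-1}`
as `t → +∞`. -/
def HasAsympExpansion (n : ℕ) (g : ℝ → ℂ) (E : Set ℝ) (C : ℝ → ℕ → ℂ) : Prop :=
  (∀ α k, C α k ≠ 0 → α ∈ E ∧ 1 ≤ k ∧ k ≤ n) ∧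
  ∀ M : ℝ, ∃ K : ℝ, ∀ t : ℝ, 2 ≤ t →
    ‖g t - partialSum n E C M t‖ ≤ K * t ^ (-M)

/-- A set of exponents consisting of negative numbers, finite above any `-M`. -/
def LocallyFiniteBelow (E : Set ℝ) : Prop :=
  E ⊆ Set.Iio 0 ∧ ∀ M : ℝ, {β ∈ E | -M ≤ β}.Finite

/-- The set `S(f)` of pairs `(α,k)` appearing with a nonzero coefficient in the asymptotic
expansion of `I(t;φ)` for amplitudes `φ` supported arbitrarily close to the origin. -/
def OscSet (U : Set (Fin n → ℝ)) (f : (Fin n → ℝ) → ℝ) : Set (ℝ × ℕ) :=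
  {p | ∀ V ∈ 𝓝 (0 : Fin n → ℝ), ∃ φ : (Fin n → ℝ) → ℂ, IsAmplitude U V φ ∧
      ∃ E C, LocallyFiniteBelow E ∧ HasAsympExpansion n (oscInt f φ) E C ∧ C p.1 p.2 ≠ 0}

/-- The cone spanned by the vectors `g j`, `j ∈ s`. -/
def coneSpanSub (g : Fin n → (Fin n → ℝ)) (s : Finset (Fin n)) : Set (Fin n → ℝ) :=
  {x | ∃ c : Fin n → ℝ, (∀ j, 0 ≤ c j) ∧ (∀ j ∉ s, c j = 0) ∧ x = ∑ j, c j • g j}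

/-- The cone spanned by all the vectors `g j`. -/
def coneSpan (g : Fin n → (Fin n → ℝ)) : Set (Fin n → ℝ) := coneSpanSub g Finset.univ

/-- `l(a) = min {⟨a,α⟩ : α ∈ Γ}`. -/
noncomputable def lval (Γ : Set (Fin n → ℝ)) (a : Fin n → ℝ) : ℝ := sInf (dot a '' Γ)

/-- Real matrix of skeleton vectors. -/
def genR (a : Fin n → (Fin n → ℕ)) : Fin n → (Fin n → ℝ) := fun j => natPt (a j)

/-- A simplicial subdivision `Σ` of the fan `Σ₀` associated with `Γ`, presented via the
skeletons of its `n`-dimensional cones: each maximal cone is unimodular (its skeleton can be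
completed to a basis of the lattice `ℤⁿ`), the cones cover `ℝ₊ⁿ`, each cone lies in a cone
`closure(γ*)` of the fan `Σ₀`, and two cones intersect in a common face. -/
structure SimplicialSubdivision (n : ℕ) (Γ : Set (Fin n → ℝ)) where
  ι : Type
  fin : Fintype ι
  gen : ι → Fin n → (Fin n → ℕ)
  unimodular : ∀ σ, (Matrix.det (Matrix.of fun j k => (gen σ j k : ℤ))).natAbs = 1
  covers : ∀ x ∈ octant n, ∃ σ, x ∈ coneSpan (genR (gen σ))
  subordinate : ∀ σ, ∃ γ, IsFaceOf Γ γ ∧ γ.Nonempty ∧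
      ∀ j, ∀ y ∈ γ, dot (natPt (gen σ j)) y = lval Γ (natPt (gen σ j))
  compatible : ∀ σ τ, ∃ s : Finset (Fin n),
      (∀ j ∈ s, gen σ j ∈ Set.range (gen τ)) ∧
      coneSpan (genR (gen σ)) ∩ coneSpan (genR (gen τ)) = coneSpanSub (genR (gen σ)) s

/-- The set `Σ^{(1)}` of primitive generators of the one-dimensional cones of `Σ`. -/
def sigma1 {n : ℕ} {Γ : Set (Fin n → ℝ)} (S : SimplicialSubdivision n Γ) :
    Set (Fin n → ℕ) :=
  {a | ∃ σ j, S.gen σ j = a}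

/-- The set `{-(⟨a⟩+ν)/l(a) : ν ∈ ℤ₊, a ∈ Σ̃^{(1)}}`. -/
noncomputable def expSetMain {n : ℕ} (Γ : Set (Fin n → ℝ))
    (S : SimplicialSubdivision n Γ) : Set ℝ :=
  {r | ∃ a ∈ sigma1 S, 0 < lval Γ (natPt a) ∧
        ∃ ν : ℕ, r = -((∑ i, (a i : ℝ)) + (ν : ℝ)) / lval Γ (natPt a)}

/-- The full candidate set `{-(⟨a⟩+ν)/l(a)} ∪ (-ℕ)`. -/
noncomputable def expSet {n : ℕ} (Γ : Set (Fin n → ℝ))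
    (S : SimplicialSubdivision n Γ) : Set ℝ :=
  expSetMain Γ S ∪ {r | ∃ m : ℕ, r = -((m : ℝ) + 1)}

/-- `G` has at `s₀` a pole of order at most `m` (in particular `G` may be analytic there). -/
def PoleOrderAtMost (G : ℂ → ℂ) (s₀ : ℂ) (m : ℕ) : Prop :=
  ∃ h : ℂ → ℂ, AnalyticAt ℂ h s₀ ∧ ∀ᶠ s in 𝓝[≠] s₀, (s - s₀) ^ m * G s = h s


open Classical in
/-- `A_V(N) = {α ∈ T_V(ℤ₊ⁿ) : ⟨α⟩ < N}`. -/
noncomputable def ASetF (n : ℕ) (V : Finset (Fin n)) (N : ℕ) : Finset (Fin n → ℕ) :=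
  (Fintype.piFinset fun _ : Fin n => Finset.range (N + 1)).filter
    (fun α => (∀ j ∈ V, α j = 0) ∧ ∑ i, α i < N)

open Classical in
/-- `B_V(N) = {α ∈ T_V(ℤ₊ⁿ) : ⟨α⟩ = N}`. -/
noncomputable def BSetF (n : ℕ) (V : Finset (Fin n)) (N : ℕ) : Finset (Fin n → ℕ) :=
  (Fintype.piFinset fun _ : Fin n => Finset.range (N + 1)).filter
    (fun α => (∀ j ∈ V, α j = 0) ∧ ∑ i, α i = N)

/-- `v` is a vertex (0-dimensional face) of `P`. -/
def IsVertex (P : Set (Fin n → ℝ)) (v : Fin n → ℝ) : Prop := IsFaceOf P {v}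

/-- Membership in the class `Ě[P](U)`: an element of `Ê[P](U)` expressible as
`Σ_{p∈S} x^p ψ_p(x)` with `S ⊆ P ∩ ℤ₊ⁿ` finite containing all vertices of `P`, and
`ψ_p(0) ≠ 0` for each vertex `p`. -/
def MemEcheck (P U : Set (Fin n → ℝ)) (f : (Fin n → ℝ) → ℝ) : Prop :=
  MemEhatP P U f ∧
  ∃ S : Finset (Fin n → ℕ), (∀ p ∈ S, natPt p ∈ P) ∧
    (∀ v, IsVertex P v → ∃ p ∈ S, natPt p = v) ∧
    ∃ ψ : (Fin n → ℕ) → (Fin n → ℝ) → ℝ,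
      (∀ p ∈ S, ContDiffOn ℝ (⊤ : ℕ∞) (ψ p) U) ∧
      (∀ p ∈ S, IsVertex P (natPt p) → ψ p 0 ≠ 0) ∧
      ∀ x ∈ U, f x = ∑ p ∈ S, (∏ i, x i ^ p i) * ψ p x

/-- Membership in the class `Ẽ(U)`: functions of the form `Σ_{p∈S} x^p ψ_p(x)` with
`ψ_p(0) ≠ 0` for all `p ∈ S`. -/
def MemEtilde (U : Set (Fin n → ℝ)) (f : (Fin n → ℝ) → ℝ) : Prop :=
  ∃ S : Finset (Fin n → ℕ), ∃ ψ : (Fin n → ℕ) → (Fin n → ℝ) → ℝ,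
    (∀ p ∈ S, ContDiffOn ℝ (⊤ : ℕ∞) (ψ p) U) ∧ (∀ p ∈ S, ψ p 0 ≠ 0) ∧
    ∀ x ∈ U, f x = ∑ p ∈ S, (∏ i, x i ^ p i) * ψ p x

/-- Membership in the Denjoy–Carleman class `ℰ_M(U)`. -/
def MemDC (M : ℕ → ℝ) (U : Set (Fin n → ℝ)) (f : (Fin n → ℝ) → ℝ) : Prop :=
  ContDiffOn ℝ (⊤ : ℕ∞) f U ∧
  ∀ K : Set (Fin n → ℝ), K ⊆ U → IsCompact K →
    ∃ A B : ℝ, 0 < A ∧ 0 < B ∧ ∀ x ∈ K, ∀ α : Fin n → ℕ,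
      |mderiv α f x| ≤ A * B ^ (∑ i, α i) * ((∏ i, Nat.factorial (α i) : ℕ) : ℝ) *
        M (∑ i, α i)

open Classical in
/-- The multi-index `α - 1` from the proof of Proposition 9.5:
`(α-1)_j = l_jλ - m_j` for `j ∈ B_λ`, `(α-1)_n = λ - 1`, and `0` otherwise. -/
noncomputable def alphaIdx (n lam : ℕ) (l m : Fin n → ℕ) (Bl : Finset (Fin n)) :
    Fin (n+1) → ℕ :=
  fun i => if h : i = Fin.last n then lam - 1
    else if i.castPred h ∈ Bl then l (i.castPred h) * lam - m (i.castPred h) else 0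

open Classical in
/-- The constant `C_λ` of Proposition 9.5. -/
noncomputable def Cval (n lam : ℕ) (l m : Fin n → ℕ) (Bl : Finset (Fin n))
    (η : (Fin (n+1) → ℝ) → ℝ) : ℝ :=
  (1 / (Nat.factorial (lam - 1) : ℝ)) *
  (∏ j ∈ Bl, ((l j : ℝ) *
      ∏ ν ∈ Finset.Icc 1 (l j * lam - m j),
        (((l j * lam : ℕ) : ℝ) - (m j : ℝ) + 1 - (ν : ℝ)))⁻¹) *
  (if Bl = Finset.univ then mderiv (alphaIdx n lam l m Bl) η 0
   else ∫ z : {j : Fin n // j ∉ Bl} → ℝ in {z | ∀ j, 0 ≤ z j},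
     mderiv (alphaIdx n lam l m Bl) η
       (fun i => if h : i = Fin.last n then 0
         else if hj : i.castPred h ∈ Bl then 0 else z ⟨i.castPred h, hj⟩))

/-- An integral of holomorphic functions dominated near `s₀` is complex differentiable at `s₀`. -/
theorem differentiableAt_integral_of_dominated {α : Type*} [MeasurableSpace α] {μ : Measure α}
    {F : ℂ → α → ℂ} {g : α → ℝ} {s₀ : ℂ} {r : ℝ} (hr : 0 < r)
    (hmeas : ∀ s ∈ Metric.ball s₀ r, AEStronglyMeasurable (F s) μ)
    (hdiff : ∀ᵐ y ∂μ, DifferentiableOn ℂ (fun s => F s y) (Metric.ball s₀ r))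
    (hbound : ∀ᵐ y ∂μ, ∀ s ∈ Metric.ball s₀ r, ‖F s y‖ ≤ g y) (hg : Integrable g μ) :
    DifferentiableAt ℂ (fun s => ∫ y, F s y ∂μ) s₀ := by
  have hsub : ∀ s ∈ Metric.ball s₀ (r / 4), Metric.closedBall s (r / 4) ⊆ Metric.ball s₀ r := by
    intro s hs t ht
    rw [Metric.mem_ball] at *
    rw [Metric.mem_closedBall] at ht
    linarith [dist_triangle t s s₀]
  have hs₀ : s₀ ∈ Metric.ball s₀ r := Metric.mem_ball_self hr
  have hderiv : ∀ᵐ y ∂μ, ∀ s ∈ Metric.ball s₀ (r / 4),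
      HasDerivAt (fun s => F s y) (deriv (fun s => F s y) s) s := by
    filter_upwards [hdiff] with y hy s hs
    exact (hy.differentiableAt (Metric.isOpen_ball.mem_nhds
      (hsub s hs (Metric.mem_closedBall_self (by positivity))))).hasDerivAt
  refine (hasDerivAt_integral_of_dominated_loc_of_deriv_le
    (F' := fun s y => deriv (fun s => F s y) s) (bound := fun y => g y / (r / 4))
    (Metric.ball_mem_nhds s₀ (by positivity : 0 < r / 4)) ?_ ?_ ?_ ?_ (hg.div_const _)
    hderiv).2.differentiableAt
  · filter_upwards [Metric.ball_mem_nhds s₀ hr] with s hs using hmeas s hs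
  · exact hg.mono' (hmeas s₀ hs₀) (hbound.mono fun y hy => hy s₀ hs₀)
  · set u : ℕ → ℂ := fun k => ((r / 4 * (1 / ((k : ℝ) + 1)) / 2 : ℝ) : ℂ) with hu
    have hu0 : ∀ k, u k ≠ 0 := fun k => by
      exact Complex.ofReal_ne_zero.2 (by positivity)
    have hub : ∀ k, s₀ + u k ∈ Metric.ball s₀ r := fun k => by
      rw [Metric.mem_ball, dist_eq_norm, add_sub_cancel_left, Complex.norm_real,
        Real.norm_of_nonneg (by positivity)]
      have : 1 / ((k : ℝ) + 1) ≤ 1 := by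
        rw [div_le_one (by positivity)]; linarith [(Nat.cast_nonneg k : (0 : ℝ) ≤ k)]
      nlinarith
    have hut : Tendsto u atTop (𝓝 0) := by
      have h1 := ((tendsto_one_div_add_atTop_nhds_zero_nat (𝕜 := ℝ)).const_mul (r / 4)).div_const 2
      rw [mul_zero, zero_div] at h1
      exact (Complex.continuous_ofReal.tendsto' 0 0 Complex.ofReal_zero).comp h1
    refine aestronglyMeasurable_of_tendsto_ae atTop
      (f := fun k y => (u k)⁻¹ • (F (s₀ + u k) y - F s₀ y))
      (fun k => ((hmeas _ (hub k)).sub (hmeas _ hs₀)).const_smul (u k)⁻¹) ?_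
    filter_upwards [hderiv] with y hy
    exact (hy s₀ (Metric.mem_ball_self (by positivity))).tendsto_slope_zero.comp
      (tendsto_nhdsWithin_iff.2 ⟨hut, Eventually.of_forall hu0⟩)
  · filter_upwards [hdiff, hbound] with y hy hb s hs
    refine Complex.norm_deriv_le_of_forall_mem_sphere_norm_le (by positivity) ?_
      fun t ht => hb t (hsub s hs (Metric.sphere_subset_closedBall ht))
    exact DifferentiableOn.diffContOnCl (hy.mono
      (Metric.closure_ball_subset_closedBall.trans (hsub s hs)))

/-- Integration by parts for the one-dimensional Mellin integral. -/
theorem integral_Ioi_cpow_mul_eq {w : ℂ} (hw : 0 ≤ w.re) {f f' : ℝ → ℝ}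
    (hf : ∀ t, HasDerivAt f (f' t) t) (hf' : Continuous f') (hs : HasCompactSupport f)
    (hs' : HasCompactSupport f') :
    ∫ t in Ioi (0 : ℝ), (t : ℂ) ^ w * f t =
      -(w + 1)⁻¹ * ∫ t in Ioi (0 : ℝ), (t : ℂ) ^ (w + 1) * f' t := by
  have hfc : Continuous f := continuous_iff_continuousAt.2 fun t => (hf t).continuousAt
  have hw1 : w + 1 ≠ 0 := fun h => by
    have := congrArg Complex.re h; simp at this; linarith
  have hint : ∀ {v : ℂ} {g : ℝ → ℝ}, 0 ≤ v.re → Continuous g → HasCompactSupport g →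
      IntegrableOn (fun t : ℝ => (t : ℂ) ^ v * g t) (Ioi 0) := by
    intro v g hv hg hgs
    have h1 : Integrable (fun t : ℝ => (1 + |t|) ^ v.re * ‖g t‖) := by
      refine Continuous.integrable_of_hasCompactSupport ?_ hgs.norm.mul_left
      exact ((continuous_const.add continuous_abs).rpow_const fun t => Or.inr hv).mul hg.norm
    refine h1.integrableOn.mono' ?_ ?_
    · exact (((Complex.measurable_ofReal.pow_const v).mul
        (Complex.measurable_ofReal.comp hg.measurable))).aestronglyMeasurable
    · filter_upwards [ae_restrict_mem measurableSet_Ioi] with t ht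
      rw [norm_mul, Complex.norm_real, Complex.norm_cpow_eq_rpow_re_of_pos ht]
      gcongr
      · exact le_of_lt ht
      · linarith [le_abs_self t]
  have hlim : Tendsto (fun t : ℝ => (t : ℂ) ^ (w + 1) * f t) atTop (𝓝 0) := by
    refine tendsto_const_nhds.congr' ?_
    have h0 : ∀ᶠ t in atTop, f t = 0 :=
      atTop_le_cocompact (mem_of_superset hs.isCompact.compl_mem_cocompact
        fun t ht => image_eq_zero_of_notMem_tsupport ht)
    filter_upwards [h0] with t ht using by simp [ht]
  have key := integral_Ioi_of_hasDerivAt_of_tendsto (a := 0)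
    (f := fun t : ℝ => (t : ℂ) ^ (w + 1) * f t)
    (f' := fun t : ℝ => (w + 1) * ((t : ℂ) ^ w * f t) + (t : ℂ) ^ (w + 1) * f' t)
    ?_ ?_ (((hint hw hfc hs).const_mul _).add (hint (by simp; linarith) hf' hs')) hlim
  · rw [integral_add ((hint hw hfc hs).const_mul _) (hint (by simp; linarith) hf' hs'),
      integral_const_mul] at key
    simp [Complex.zero_cpow hw1] at key
    field_simp
    linear_combination key
  · refine ContinuousAt.continuousWithinAt (ContinuousAt.mul ?_ (by fun_prop))
    exact Complex.continuousAt_ofReal_cpow_const 0 (w + 1) (Or.inl (by simp; linarith))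
  · intro t ht
    have h1 := (hasDerivAt_ofReal_cpow_const (x := t) (r := w + 1) (ne_of_gt ht) hw1).mul
      (hf t).ofReal_comp
    refine h1.congr_deriv ?_
    rw [add_sub_cancel_right]
    ring

theorem contDiff_pderiv1 {f : (Fin n → ℝ) → ℝ} (hf : ContDiff ℝ (⊤ : ℕ∞) f) (i : Fin n) :
    ContDiff ℝ (⊤ : ℕ∞) (pderiv1 i f) :=
  (hf.fderiv_right (m := (⊤ : ℕ∞)) (by simp)).clm_apply contDiff_const

theorem hasCompactSupport_pderiv1 {f : (Fin n → ℝ) → ℝ} (hf : HasCompactSupport f) (i : Fin n) :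
    HasCompactSupport (pderiv1 i f) :=
  hf.fderiv_apply (𝕜 := ℝ) _

theorem pderiv1_comm {f : (Fin n → ℝ) → ℝ} (hf : ContDiff ℝ (⊤ : ℕ∞) f) (i j : Fin n) :
    pderiv1 i (pderiv1 j f) = pderiv1 j (pderiv1 i f) := by
  have hd : Differentiable ℝ (fderiv ℝ f) :=
    (hf.fderiv_right (m := (⊤ : ℕ∞)) (by simp)).differentiable (by simp)
  ext x
  have hsymm := (hf.contDiffAt (x := x)).isSymmSndFDerivAt
    (by rw [minSmoothness_of_isRCLikeNormedField]; exact WithTop.coe_le_coe.2 le_top)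
  unfold pderiv1
  rw [fderiv_clm_apply (hd x) (differentiableAt_const _),
    fderiv_clm_apply (hd x) (differentiableAt_const _)]
  simpa using hsymm (Pi.single i 1) (Pi.single j 1)

theorem iterate_pderiv1 (P : ((Fin n → ℝ) → ℝ) → Prop) {i : Fin n}
    (hP : ∀ f, P f → P (pderiv1 i f)) {f : (Fin n → ℝ) → ℝ} (hf : P f) (k : ℕ) :
    P ((pderiv1 i)^[k] f) :=
  Function.Iterate.rec P hf hP k

theorem foldr_pderiv1 (P : ((Fin n → ℝ) → ℝ) → Prop) (hP : ∀ i f, P f → P (pderiv1 i f))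
    {f : (Fin n → ℝ) → ℝ} (hf : P f) (α : Fin n → ℕ) (L : List (Fin n)) :
    P (L.foldr (fun i g => (pderiv1 i)^[α i] g) f) := by
  induction L with
  | nil => exact hf
  | cons j L ih => exact iterate_pderiv1 P (hP j) ih _

theorem contDiff_mderiv {f : (Fin n → ℝ) → ℝ} (hf : ContDiff ℝ (⊤ : ℕ∞) f) (α : Fin n → ℕ) :
    ContDiff ℝ (⊤ : ℕ∞) (mderiv α f) :=
  foldr_pderiv1 (ContDiff ℝ (⊤ : ℕ∞)) (fun i _ h => contDiff_pderiv1 h i) hf α _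

theorem hasCompactSupport_mderiv {f : (Fin n → ℝ) → ℝ} (hf : HasCompactSupport f)
    (α : Fin n → ℕ) : HasCompactSupport (mderiv α f) :=
  foldr_pderiv1 HasCompactSupport (fun i _ h => hasCompactSupport_pderiv1 h i) hf α _

theorem pderiv1_iterate_comm {f : (Fin n → ℝ) → ℝ} (hf : ContDiff ℝ (⊤ : ℕ∞) f) (i j : Fin n)
    (k : ℕ) : pderiv1 i ((pderiv1 j)^[k] f) = (pderiv1 j)^[k] (pderiv1 i f) := by
  induction k with
  | zero => rfl
  | succ k ih =>
    rw [Function.iterate_succ_apply', Function.iterate_succ_apply', pderiv1_comm, ih]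
    exact iterate_pderiv1 (ContDiff ℝ (⊤ : ℕ∞)) (fun _ h => contDiff_pderiv1 h j) hf k

theorem mderiv_zero (f : (Fin n → ℝ) → ℝ) : mderiv 0 f = f := by
  unfold mderiv
  induction List.finRange n with
  | nil => rfl
  | cons j L ih => simp

theorem mderiv_add_single {f : (Fin n → ℝ) → ℝ} (hf : ContDiff ℝ (⊤ : ℕ∞) f) (α : Fin n → ℕ)
    (i : Fin n) : mderiv (α + Pi.single i 1) f = pderiv1 i (mderiv α f) := by
  have key : ∀ L : List (Fin n), L.Nodup →
      L.foldr (fun j g => (pderiv1 j)^[(α + Pi.single i 1 : Fin n → ℕ) j] g) f =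
        if i ∈ L then pderiv1 i (L.foldr (fun j g => (pderiv1 j)^[α j] g) f)
        else L.foldr (fun j g => (pderiv1 j)^[α j] g) f := by
    intro L
    induction L with
    | nil => intro _; simp
    | cons j L ih =>
      intro hL
      rw [List.nodup_cons] at hL
      rw [List.foldr_cons, List.foldr_cons, ih hL.2]
      rcases eq_or_ne i j with rfl | hij
      · simp [hL.1, Function.iterate_succ_apply']
      · have hj : (α + Pi.single i 1 : Fin n → ℕ) j = α j := by simp [hij.symm]
        rw [hj]
        by_cases hi : i ∈ L
        · simp only [hi, if_true, List.mem_cons, or_true]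
          rw [pderiv1_iterate_comm]
          exact foldr_pderiv1 (ContDiff ℝ (⊤ : ℕ∞)) (fun i _ h => contDiff_pderiv1 h i) hf α L
        · simp [hi, hij]
  have := key _ (List.nodup_finRange n)
  rwa [if_pos (List.mem_finRange i)] at this

/-- Induction on multi-indices, raising one entry at a time. -/
theorem multiIndex_induction {ι : Type*} [Fintype ι] [DecidableEq ι] {P : (ι → ℕ) → Prop}
    (zero : P 0) (add_single : ∀ α i, P α → P (α + Pi.single i 1)) (α : ι → ℕ) : P α := by
  induction hk : ∑ i, α i generalizing α with
  | zero =>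
    have : α = 0 := by ext i; simpa using (Finset.sum_eq_zero_iff.1 hk) i (Finset.mem_univ i)
    exact this ▸ zero
  | succ k ih =>
    obtain ⟨i, hi⟩ : ∃ i, α i ≠ 0 := by
      by_contra! h
      simp [h] at hk
    have hα : α - Pi.single i 1 + Pi.single i 1 = α := by
      ext j
      rcases eq_or_ne j i with rfl | hj
      · simp; omega
      · simp [hj]
    rw [← hα]
    refine add_single _ _ (ih _ ?_)
    have := congrArg (fun β : ι → ℕ => ∑ j, β j) hα
    simp only [Pi.add_apply, Finset.sum_add_distrib, Finset.sum_pi_single', Finset.mem_univ,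
      if_true, hk] at this
    omega

theorem mderiv_add {φ : (Fin n → ℝ) → ℝ} (hφ : ContDiff ℝ (⊤ : ℕ∞) φ) (M N : Fin n → ℕ) :
    mderiv (M + N) φ = mderiv N (mderiv M φ) := by
  induction N using multiIndex_induction with
  | zero => simp [mderiv_zero]
  | add_single N i ih =>
    rw [← add_assoc, mderiv_add_single hφ, ih, mderiv_add_single (contDiff_mderiv hφ M)]

theorem mderiv_comp_neg_coord {f : (Fin n → ℝ) → ℝ} (hf : ContDiff ℝ (⊤ : ℕ∞) f) (i : Fin n)
    (α : Fin n → ℕ) (x : Fin n → ℝ) :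
    mderiv α (fun y => f (Function.update y i (-y i))) x =
      (-1) ^ α i * mderiv α f (Function.update x i (-x i)) := by
  set L : (Fin n → ℝ) →L[ℝ] (Fin n → ℝ) := ContinuousLinearMap.pi fun j =>
    (if j = i then (-1 : ℝ) else 1) • ContinuousLinearMap.proj j
  have hL : ∀ y, Function.update y i (-y i) = L y := by
    intro y
    ext j
    rcases eq_or_ne j i with rfl | hj <;> simp [L, *]
  have hLs : ∀ j, L (Pi.single j 1) = (if j = i then (-1 : ℝ) else 1) • Pi.single j (1 : ℝ) := by
    intro j
    ext k
    simp only [L, ContinuousLinearMap.coe_pi', smul_apply, ContinuousLinearMap.proj_apply,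
      Pi.smul_apply, smul_eq_mul]
    rcases eq_or_ne k j with rfl | hk <;> simp [*]
  simp only [hL]
  have hsm : ContDiff ℝ (⊤ : ℕ∞) (fun y => f (L y)) := hf.comp L.contDiff
  induction α using multiIndex_induction generalizing x with
  | zero => simp [mderiv_zero]
  | add_single α j ih =>
    rw [mderiv_add_single hsm, mderiv_add_single hf, funext ih]
    have hd : Differentiable ℝ (mderiv α f) := (contDiff_mderiv hf α).differentiable (by simp)
    have h1 := (((hd (L x)).hasFDerivAt.comp x L.hasFDerivAt).const_mul ((-1 : ℝ) ^ α i)).fderiv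
    unfold pderiv1
    simp only [Function.comp_def] at h1
    rw [h1]
    simp only [smul_apply, ContinuousLinearMap.comp_apply, hLs, map_smul,
      smul_eq_mul]
    rcases eq_or_ne j i with rfl | hj
    · simp [pow_succ]
    · simp [hj, hj.symm]

/-- The product power `∏ᵢ yᵢ ^ zᵢ`. -/
noncomputable def cpowProd (z : Fin n → ℂ) (y : Fin n → ℝ) : ℂ := ∏ i, (y i : ℂ) ^ z i

/-- The coordinate measures whose product is integration over the face
`{yᵢ = 0 for i ∈ S}` of the positive octant. -/
noncomputable def faceMeasure (S : Finset (Fin n)) (i : Fin n) : Measure ℝ :=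
  if i ∈ S then Measure.dirac 0 else volume.restrict (Ioi 0)

instance (S : Finset (Fin n)) (i : Fin n) : SigmaFinite (faceMeasure S i) := by
  unfold faceMeasure; split_ifs <;> infer_instance

instance (S : Finset (Fin n)) (i : Fin n) : IsLocallyFiniteMeasure (faceMeasure S i) := by
  unfold faceMeasure; split_ifs <;> infer_instance

theorem faceMeasure_empty (i : Fin n) : faceMeasure ∅ i = volume.restrict (Ioi 0) := by
  simp [faceMeasure]

/-- The integral of `∏ᵢ yᵢ ^ zᵢ · φ` over the positive octant. -/
noncomputable def octantMellin (z : Fin n → ℂ) (φ : (Fin n → ℝ) → ℝ) : ℂ :=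
  ∫ y, cpowProd z y * φ y ∂Measure.pi (faceMeasure ∅)

theorem ae_pos_faceMeasure : ∀ᵐ y ∂Measure.pi (faceMeasure (∅ : Finset (Fin n))), ∀ i, 0 < y i := by
  rw [ae_all_iff]
  intro i
  have h : ∀ᵐ t ∂faceMeasure (∅ : Finset (Fin n)) i, 0 < t := by
    rw [faceMeasure_empty]
    exact ae_restrict_mem measurableSet_Ioi
  exact (Measure.quasiMeasurePreserving_eval (faceMeasure ∅) i).ae h

theorem measurable_cpowProd (z : Fin n → ℂ) : Measurable (cpowProd z) :=
  Finset.measurable_prod _ fun i _ =>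
    (Complex.measurable_ofReal.comp (measurable_pi_apply i)).pow_const (z i)

theorem aestronglyMeasurable_cpowProd_mul {φ : (Fin n → ℝ) → ℝ} (hφ : Continuous φ)
    (z : Fin n → ℂ) (μ : Measure (Fin n → ℝ)) :
    AEStronglyMeasurable (fun y => cpowProd z y * φ y) μ :=
  ((measurable_cpowProd z).mul
    (Complex.measurable_ofReal.comp hφ.measurable)).aestronglyMeasurable

theorem norm_cpowProd_mul_le {z : Fin n → ℂ} {M : ℝ} (hz : ∀ i, 0 ≤ (z i).re)
    (hM : ∀ i, (z i).re ≤ M) (φ : (Fin n → ℝ) → ℝ) {y : Fin n → ℝ} (hy : ∀ i, 0 < y i) :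
    ‖cpowProd z y * φ y‖ ≤ (∏ i, (1 + |y i|) ^ M) * ‖φ y‖ := by
  rw [norm_mul, Complex.norm_real, cpowProd, norm_prod]
  gcongr with i
  rw [Complex.norm_cpow_eq_rpow_re_of_pos (hy i)]
  calc y i ^ (z i).re ≤ (1 + |y i|) ^ (z i).re :=
        Real.rpow_le_rpow (hy i).le (by linarith [le_abs_self (y i)]) (hz i)
    _ ≤ (1 + |y i|) ^ M :=
        Real.rpow_le_rpow_of_exponent_le (by linarith [abs_nonneg (y i)]) (hM i)

theorem integrable_prod_rpow_mul {φ : (Fin n → ℝ) → ℝ} (hφ : Continuous φ)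
    (hs : HasCompactSupport φ) (M : ℝ) (S : Finset (Fin n)) :
    Integrable (fun y => (∏ i, (1 + |y i|) ^ M) * ‖φ y‖) (Measure.pi (faceMeasure S)) := by
  refine Continuous.integrable_of_hasCompactSupport (.mul ?_ hφ.norm) hs.norm.mul_left
  refine continuous_finsetProd _ fun i _ => Continuous.rpow_const (by fun_prop) fun y => ?_
  exact Or.inl (by positivity)

theorem integrable_cpowProd_mul {φ : (Fin n → ℝ) → ℝ} (hφ : Continuous φ)
    (hs : HasCompactSupport φ) {z : Fin n → ℂ} (hz : ∀ i, 0 ≤ (z i).re) :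
    Integrable (fun y => cpowProd z y * φ y) (Measure.pi (faceMeasure ∅)) := by
  refine (integrable_prod_rpow_mul hφ hs (∑ i, (z i).re) ∅).mono'
    (aestronglyMeasurable_cpowProd_mul hφ z _) ?_
  filter_upwards [ae_pos_faceMeasure] with y hy
  exact norm_cpowProd_mul_le hz (fun i => Finset.single_le_sum
    (f := fun i => (z i).re) (fun j _ => hz j) (Finset.mem_univ i)) φ hy

theorem integral_pi_insertNth {E : Type*} [NormedAddCommGroup E] [NormedSpace ℝ E]
    {μ : Fin (n + 1) → Measure ℝ} [∀ i, SigmaFinite (μ i)] (i : Fin (n + 1))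
    {F : (Fin (n + 1) → ℝ) → E} (hF : Integrable F (Measure.pi μ)) :
    ∫ y, F y ∂Measure.pi μ =
      ∫ x, ∫ t, F (i.insertNth t x) ∂μ i ∂Measure.pi fun j => μ (i.succAbove j) := by
  have hmp := (measurePreserving_piFinSuccAbove μ i).symm
  rw [← hmp.integral_comp', integral_prod_symm]
  · rfl
  · exact (hmp.integrable_comp_emb (MeasurableEquiv.measurableEmbedding _)).2 hF

theorem isClosedEmbedding_insertNth (i : Fin (n + 1)) (x : Fin n → ℝ) :
    Topology.IsClosedEmbedding (fun t : ℝ => (i.insertNth t x : Fin (n + 1) → ℝ)) :=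
  Function.LeftInverse.isClosedEmbedding (f := fun y => y i) (fun t => by simp)
    (continuous_apply i) (by fun_prop)

theorem hasDerivAt_comp_insertNth {φ : (Fin (n + 1) → ℝ) → ℝ} (hφ : Differentiable ℝ φ)
    (i : Fin (n + 1)) (x : Fin n → ℝ) (t : ℝ) :
    HasDerivAt (fun t => φ (i.insertNth t x)) (pderiv1 i φ (i.insertNth t x)) t := by
  refine (hφ _).hasFDerivAt.comp_hasDerivAt t (hasDerivAt_pi.2 fun j => ?_)
  cases j using Fin.succAboveCases i with
  | x => simpa using hasDerivAt_id' t
  | p j => simpa [i.succAbove_ne j] using hasDerivAt_const t (x j)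

/-- Integration by parts in one coordinate. -/
theorem octantMellin_eq_pderiv1 {φ : (Fin n → ℝ) → ℝ} (hφ : ContDiff ℝ (⊤ : ℕ∞) φ)
    (hs : HasCompactSupport φ) {z : Fin n → ℂ} (hz : ∀ i, 0 ≤ (z i).re) (i : Fin n) :
    octantMellin z φ =
      -(z i + 1)⁻¹ * octantMellin (z + Pi.single i 1) (pderiv1 i φ) := by
  obtain ⟨n, rfl⟩ : ∃ k, n = k + 1 := ⟨n - 1, by have := i.isLt; omega⟩
  have hφ' := contDiff_pderiv1 hφ i
  have hs' := hasCompactSupport_pderiv1 hs i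
  have hz' : ∀ j, 0 ≤ ((z + Pi.single i 1 : Fin (n + 1) → ℂ) j).re := by
    intro j
    have := hz j
    rcases eq_or_ne j i with rfl | hj
    · simp; linarith
    · simpa [hj] using this
  unfold octantMellin
  rw [integral_pi_insertNth i (integrable_cpowProd_mul hφ.continuous hs hz),
    integral_pi_insertNth i (integrable_cpowProd_mul hφ'.continuous hs' hz'),
    ← integral_const_mul]
  refine integral_congr_ae (Eventually.of_forall fun x => ?_)
  have key := integral_Ioi_cpow_mul_eq (hz i)
    (hasDerivAt_comp_insertNth (hφ.differentiable (by simp)) i x)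
    (hφ'.continuous.comp (isClosedEmbedding_insertNth i x).continuous)
    (hs.comp_isClosedEmbedding (isClosedEmbedding_insertNth i x))
    (hs'.comp_isClosedEmbedding (isClosedEmbedding_insertNth i x))
  simp only [faceMeasure_empty, cpowProd, Fin.prod_univ_succAbove _ i, Fin.insertNth_apply_same,
    Fin.insertNth_apply_succAbove, Pi.add_apply, Pi.single_eq_same, ne_eq, Fin.succAbove_ne,
    not_false_eq_true, Pi.single_eq_of_ne, add_zero, mul_right_comm _ (∏ j, _)]
  rw [integral_mul_const, integral_mul_const, key]
  ring

theorem integral_faceMeasure_pderiv1 {ψ : (Fin n → ℝ) → ℝ} (hψ : ContDiff ℝ (⊤ : ℕ∞) ψ)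
    (hs : HasCompactSupport ψ) {S : Finset (Fin n)} {i : Fin n} (hi : i ∉ S) :
    ∫ y, pderiv1 i ψ y ∂Measure.pi (faceMeasure S) =
      -∫ y, ψ y ∂Measure.pi (faceMeasure (insert i S)) := by
  obtain ⟨n, rfl⟩ : ∃ k, n = k + 1 := ⟨n - 1, by have := i.isLt; omega⟩
  have hψ' := contDiff_pderiv1 hψ i
  have hs' := hasCompactSupport_pderiv1 hs i
  rw [integral_pi_insertNth i (hψ'.continuous.integrable_of_hasCompactSupport hs'),
    integral_pi_insertNth i (hψ.continuous.integrable_of_hasCompactSupport hs),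
    ← integral_neg]
  have hμ : (fun j => faceMeasure S (i.succAbove j)) =
      fun j => faceMeasure (insert i S) (i.succAbove j) := by
    ext1 j
    simp [faceMeasure, Fin.succAbove_ne]
  have h1 : faceMeasure S i = volume.restrict (Ioi 0) := by simp [faceMeasure, hi]
  have h2 : faceMeasure (insert i S) i = Measure.dirac 0 := by simp [faceMeasure]
  rw [hμ, h1, h2]
  refine integral_congr_ae (Eventually.of_forall fun x => ?_)
  have hd := hasDerivAt_comp_insertNth (hψ.differentiable (by simp)) i x
  have key := HasCompactSupport.integral_Ioi_deriv_eq
    (f := fun t => ψ (i.insertNth t x)) ?_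
    (hs.comp_isClosedEmbedding (isClosedEmbedding_insertNth i x)) 0
  · simp only [(hd _).deriv] at key
    simpa using key
  · refine contDiff_one_iff_deriv.2 ⟨fun t => (hd t).differentiableAt, ?_⟩
    rw [show deriv (fun t => ψ (i.insertNth t x)) = _ from funext fun t => (hd t).deriv]
    exact hψ'.continuous.comp (isClosedEmbedding_insertNth i x).continuous

theorem integral_mderiv_add_indicator {φ : (Fin n → ℝ) → ℝ} (hφ : ContDiff ℝ (⊤ : ℕ∞) φ)
    (hs : HasCompactSupport φ) (S : Finset (Fin n)) (α : Fin n → ℕ) :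
    ∫ y, mderiv (α + ∑ i ∈ S, Pi.single i 1) φ y ∂Measure.pi (faceMeasure ∅) =
      (-1) ^ S.card * ∫ y, mderiv α φ y ∂Measure.pi (faceMeasure S) := by
  induction S using Finset.induction_on generalizing α with
  | empty => simp
  | insert j S hj ih =>
    rw [Finset.sum_insert hj, ← add_assoc, ih, mderiv_add_single hφ,
      integral_faceMeasure_pderiv1 (contDiff_mderiv hφ α) (hasCompactSupport_mderiv hs α) hj,
      Finset.card_insert_of_notMem hj]
    ring

/-- The product of reciprocals produced by `N` iterated integrations by parts. -/
noncomputable def ibpFactor (N : Fin n → ℕ) (z : Fin n → ℂ) : ℂ :=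
  ∏ i, ∏ ν ∈ Finset.range (N i), -(z i + ν + 1)⁻¹

theorem ibpFactor_add (M N : Fin n → ℕ) (z : Fin n → ℂ) :
    ibpFactor (M + N) z = ibpFactor M z * ibpFactor N (fun i => z i + M i) := by
  simp only [ibpFactor, ← Finset.prod_mul_distrib, Pi.add_apply, Finset.prod_range_add]
  push_cast
  simp only [add_assoc]

theorem ibpFactor_single (i : Fin n) (z : Fin n → ℂ) :
    ibpFactor (Pi.single i 1) z = -(z i + 1)⁻¹ := by
  rw [ibpFactor, Finset.prod_eq_single i]
  · simp
  · intro j _ hj; simp [hj]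
  · simp

theorem octantMellin_eq_mderiv {φ : (Fin n → ℝ) → ℝ} (hφ : ContDiff ℝ (⊤ : ℕ∞) φ)
    (hs : HasCompactSupport φ) {z : Fin n → ℂ} (hz : ∀ i, 0 ≤ (z i).re) (N : Fin n → ℕ) :
    octantMellin z φ =
      ibpFactor N z * octantMellin (fun i => z i + N i) (mderiv N φ) := by
  induction N using multiIndex_induction with
  | zero => simp [ibpFactor, mderiv_zero]
  | add_single N i ih =>
    rw [ih, ibpFactor_add, ibpFactor_single, octantMellin_eq_pderiv1 (contDiff_mderiv hφ N)
      (hasCompactSupport_mderiv hs N) (fun j => by simpa using by linarith [hz j]) i,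
      mderiv_add_single hφ, mul_assoc]
    congr 3
    ext j
    rcases eq_or_ne j i with rfl | hj
    · simp [add_assoc]
    · simp [hj]

theorem analyticAt_octantMellin {φ : (Fin n → ℝ) → ℝ} (hφ : Continuous φ)
    (hs : HasCompactSupport φ) {w : ℂ → Fin n → ℂ} (hw : ∀ i, Differentiable ℂ fun s => w s i)
    {s₀ : ℂ} (h₀ : ∀ᶠ s in 𝓝 s₀, ∀ i, 0 ≤ (w s i).re) :
    AnalyticAt ℂ (fun s => octantMellin (w s) φ) s₀ := by
  rw [Complex.analyticAt_iff_eventually_differentiableAt]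
  filter_upwards [h₀.eventually_nhds] with s₁ h₁
  obtain ⟨M, hM⟩ : ∃ M, ∀ i, (w s₁ i).re < M :=
    ⟨∑ i, (w s₁ i).re + 1, fun i => by
      have : (w s₁ i).re ≤ ∑ i, (w s₁ i).re := Finset.single_le_sum
        (f := fun i => (w s₁ i).re) (fun j _ => h₁.self_of_nhds j) (Finset.mem_univ i)
      linarith⟩
  have h₂ : ∀ᶠ s in 𝓝 s₁, ∀ i, (w s i).re < M := eventually_all.2 fun i =>
    (Complex.continuous_re.comp (hw i).continuous).continuousAt.eventually_lt
      continuousAt_const (hM i)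
  obtain ⟨r, hr, hball⟩ := Metric.eventually_nhds_iff_ball.1 (h₁.and h₂)
  refine differentiableAt_integral_of_dominated hr
    (fun s _ => aestronglyMeasurable_cpowProd_mul hφ _ _) ?_ ?_
    (integrable_prod_rpow_mul hφ hs M ∅)
  · filter_upwards [ae_pos_faceMeasure] with y hy
    refine Differentiable.differentiableOn (Differentiable.mul_const ?_ _)
    refine Differentiable.fun_finsetProd fun i _ => (hw i).const_cpow
      (Or.inl (Complex.ofReal_ne_zero.2 (hy i).ne'))
  · filter_upwards [ae_pos_faceMeasure] with y hy s hs
    exact norm_cpowProd_mul_le (hball s hs).1 (fun i => ((hball s hs).2 i).le) φ hy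

/-- The right-hand side of the `N`-fold integration by parts formula for `octantMellin`. -/
noncomputable def ibpTerm (φ : (Fin n → ℝ) → ℝ) (N : Fin n → ℕ) (z : Fin n → ℂ) : ℂ :=
  ibpFactor N z * octantMellin (fun i => z i + N i) (mderiv N φ)

theorem ibpTerm_add {φ : (Fin n → ℝ) → ℝ} (hφ : ContDiff ℝ (⊤ : ℕ∞) φ)
    (M N : Fin n → ℕ) (z : Fin n → ℂ) :
    ibpTerm φ (M + N) z = ibpFactor M z * ibpTerm (mderiv M φ) N (fun i => z i + M i) := by
  rw [ibpTerm, ibpTerm, ibpFactor_add, mderiv_add hφ, mul_assoc]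
  simp [add_assoc]

theorem ibpTerm_eq {φ : (Fin n → ℝ) → ℝ} (hφ : ContDiff ℝ (⊤ : ℕ∞) φ)
    (hs : HasCompactSupport φ) {M : Fin n → ℕ} (N : Fin n → ℕ) {z : Fin n → ℂ}
    (hz : ∀ i, 0 ≤ (z i + M i).re) : ibpTerm φ (M + N) z = ibpTerm φ M z := by
  rw [ibpTerm_add hφ, ibpTerm, ibpTerm, ← octantMellin_eq_mderiv (contDiff_mderiv hφ M)
    (hasCompactSupport_mderiv hs M) hz N]

theorem ibpTerm_zero (φ : (Fin n → ℝ) → ℝ) (z : Fin n → ℂ) :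
    ibpTerm φ 0 z = octantMellin z φ := by
  simp [ibpTerm, ibpFactor, mderiv_zero]

/-- The affine family of exponents `aᵢ s + bᵢ`. -/
def affineExp (a b : Fin n → ℕ) (s : ℂ) (i : Fin n) : ℂ := a i * s + b i

theorem differentiable_affineExp (a b : Fin n → ℕ) (i : Fin n) :
    Differentiable ℂ fun s => affineExp a b s i := by
  unfold affineExp; fun_prop

theorem re_affineExp_add_nonneg (a b : Fin n → ℕ) {N : ℕ} {s : ℂ} (hs : -(N : ℝ) < s.re)
    (i : Fin n) : 0 ≤ (affineExp a b s i + ((N • a) i : ℕ)).re := by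
  have h : (affineExp a b s i + ((N • a) i : ℕ)).re = a i * (s.re + N) + b i := by
    simp [affineExp]; ring
  rw [h]
  have : 0 ≤ s.re + N := by linarith
  positivity

/-- The meromorphic continuation of `s ↦ octantMellin (affineExp a b s) φ`. -/
noncomputable def octantMellinExt (a b : Fin n → ℕ) (φ : (Fin n → ℝ) → ℝ) (s : ℂ) : ℂ :=
  ibpTerm φ ((⌈-s.re⌉₊ + 1) • a) (affineExp a b s)

theorem octantMellinExt_eq_ibpTerm {φ : (Fin n → ℝ) → ℝ}
    (hφ : ContDiff ℝ (⊤ : ℕ∞) φ) (hs : HasCompactSupport φ)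
    (a b : Fin n → ℕ) {N : ℕ} {s : ℂ} (hN : -(N : ℝ) < s.re) :
    octantMellinExt a b φ s = ibpTerm φ (N • a) (affineExp a b s) := by
  have hN' : -((⌈-s.re⌉₊ + 1 : ℕ) : ℝ) < s.re := by
    push_cast
    linarith [Nat.le_ceil (-s.re)]
  rw [octantMellinExt, ← ibpTerm_eq hφ hs (N • a) (re_affineExp_add_nonneg a b hN'),
    ← ibpTerm_eq hφ hs ((⌈-s.re⌉₊ + 1) • a) (re_affineExp_add_nonneg a b hN), add_comm]

theorem octantMellinExt_eq {φ : (Fin n → ℝ) → ℝ}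
    (hφ : ContDiff ℝ (⊤ : ℕ∞) φ) (hs : HasCompactSupport φ)
    (a b : Fin n → ℕ) {s : ℂ} (h : 0 < s.re) :
    octantMellinExt a b φ s = octantMellin (affineExp a b s) φ := by
  rw [octantMellinExt_eq_ibpTerm hφ hs a b (N := 0) (by simpa using h), zero_smul, ibpTerm_zero]

theorem eventually_neg_lt_re {N : ℕ} {s₀ : ℂ} (hN : -(N : ℝ) < s₀.re) :
    ∀ᶠ s in 𝓝 s₀, -(N : ℝ) < s.re :=
  continuousAt_const.eventually_lt Complex.continuous_re.continuousAt hN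

theorem analyticAt_octantMellin_affineExp {φ : (Fin n → ℝ) → ℝ}
    (hφ : ContDiff ℝ (⊤ : ℕ∞) φ) (hs : HasCompactSupport φ)
    (a b : Fin n → ℕ) {N : ℕ} {s₀ : ℂ} (hN : -(N : ℝ) < s₀.re) :
    AnalyticAt ℂ (fun s => octantMellin (fun i => affineExp a b s i + ((N • a) i : ℕ))
      (mderiv (N • a) φ)) s₀ :=
  analyticAt_octantMellin (contDiff_mderiv hφ _).continuous (hasCompactSupport_mderiv hs _)
    (fun i => (differentiable_affineExp a b i).add_const _)
    ((eventually_neg_lt_re hN).mono fun _ h => re_affineExp_add_nonneg a b h)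

theorem meromorphicOn_octantMellinExt {φ : (Fin n → ℝ) → ℝ}
    (hφ : ContDiff ℝ (⊤ : ℕ∞) φ) (hs : HasCompactSupport φ)
    (a b : Fin n → ℕ) : MeromorphicOn (octantMellinExt a b φ) univ := by
  intro s₀ _
  obtain ⟨N, hN⟩ := exists_nat_gt (-s₀.re)
  have hN' : -(N : ℝ) < s₀.re := by linarith
  have hmer : MeromorphicAt (fun s => ibpTerm φ (N • a) (affineExp a b s)) s₀ := by
    refine MeromorphicAt.mul ?_ (analyticAt_octantMellin_affineExp hφ hs a b hN').meromorphicAt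
    refine MeromorphicAt.fun_prod fun i _ => MeromorphicAt.fun_prod fun ν _ => ?_
    refine (MeromorphicAt.inv (AnalyticAt.meromorphicAt ?_)).neg
    exact (((differentiable_affineExp a b i).analyticAt s₀).add analyticAt_const).add
      analyticAt_const
  refine hmer.congr (eventually_nhdsWithin_of_eventually_nhds ?_)
  filter_upwards [eventually_neg_lt_re hN'] with s h
  exact (octantMellinExt_eq_ibpTerm hφ hs a b h).symm

/-- If the exponents `aᵢ s + bᵢ`, `i ∈ S`, take the negative integer values `-(kᵢ + 1)` at
`s = -lam` and the other ones vanish identically, then the continuation has a pole of order at most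
`card S` at `-lam`, with leading coefficient an integral of `∂^k φ` over the face of `S`. -/
theorem exists_analyticAt_pow_mul_octantMellinExt {φ : (Fin n → ℝ) → ℝ}
    (hφ : ContDiff ℝ (⊤ : ℕ∞) φ)
    (hs : HasCompactSupport φ) {a b k : Fin n → ℕ} {S : Finset (Fin n)} {lam : ℕ}
    (hS : ∀ i ∈ S, b i + k i + 1 = a i * lam) (ha : ∀ i ∈ S, a i ≠ 0)
    (hS' : ∀ i ∉ S, a i = 0 ∧ b i = 0 ∧ k i = 0) :
    ∃ h : ℂ → ℂ, AnalyticAt ℂ h (-(lam : ℂ)) ∧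
      (∀ᶠ s in 𝓝[≠] (-(lam : ℂ)),
        (s - -(lam : ℂ)) ^ S.card * octantMellinExt a b φ s = h s) ∧
      h (-(lam : ℂ)) = (((∏ i ∈ S, ((a i : ℝ) * (k i).factorial)⁻¹) *
        ∫ y, mderiv k φ y ∂Measure.pi (faceMeasure S) : ℝ) : ℂ) := by
  set K : Fin n → ℕ := k + ∑ i ∈ S, Pi.single i 1 with hK
  have hKS : ∀ i ∈ S, K i = k i + 1 := by
    intro i hi
    simp [hK, Finset.sum_apply, Pi.single_apply, hi]
  have hKS' : ∀ i ∉ S, K i = 0 := by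
    intro i hi
    simp [hK, Finset.sum_apply, Pi.single_apply, hi, (hS' i hi).2.2]
  have hexp : ∀ s i, affineExp a b s i + K i = a i * (s + lam) := by
    intro s i
    by_cases hi : i ∈ S
    · have h := congrArg (Nat.cast (R := ℂ)) (hS i hi)
      push_cast at h
      rw [hKS i hi, affineExp]
      push_cast
      linear_combination h
    · simp [affineExp, hKS' i hi, hS' i hi]
  have hsplit : (lam + 1) • a = K + (a + b) := by
    ext i
    by_cases hi : i ∈ S
    · have := hS i hi
      simp [hKS i hi]
      linarith
    · simp [hKS' i hi, hS' i hi]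
  have hlam : -((lam + 1 : ℕ) : ℝ) < (-(lam : ℂ)).re := by simp
  have hH : AnalyticAt ℂ (fun s => ibpTerm (mderiv K φ) (a + b)
      (fun i => affineExp a b s i + K i)) (-(lam : ℂ)) := by
    refine AnalyticAt.mul ?_ ?_
    · refine Finset.analyticAt_fun_prod _ fun i _ => Finset.analyticAt_fun_prod _ fun ν _ => ?_
      refine (AnalyticAt.inv ((((differentiable_affineExp a b i).analyticAt _).add
        analyticAt_const).add analyticAt_const |>.add analyticAt_const) ?_).neg
      simp only [Pi.add_apply, hexp]
      rw [neg_add_cancel, mul_zero, zero_add]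
      exact_mod_cast Nat.succ_ne_zero ν
    · have := analyticAt_octantMellin_affineExp hφ hs a b hlam
      rw [hsplit, mderiv_add hφ] at this
      simpa [add_assoc] using this
  have hR : AnalyticAt ℂ (fun s => ∏ i ∈ S, (-(a i : ℂ)⁻¹ *
      ∏ ν ∈ Finset.range (k i), -(affineExp a b s i + ν + 1)⁻¹)) (-(lam : ℂ)) := by
    refine Finset.analyticAt_fun_prod _ fun i hi => analyticAt_const.mul ?_
    refine Finset.analyticAt_fun_prod _ fun ν hν => (AnalyticAt.inv
      ((((differentiable_affineExp a b i).analyticAt _).add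
        analyticAt_const).add analyticAt_const) ?_).neg
    have h := hexp (-(lam : ℂ)) i
    rw [hKS i hi, neg_add_cancel, mul_zero] at h
    push_cast at h
    have hν' := Finset.mem_range.1 hν
    intro h0
    simp only [Pi.add_apply] at h0
    have : (ν : ℂ) = k i := by linear_combination h0 - h
    have : ν = k i := by exact_mod_cast this
    omega
  refine ⟨_, hR.mul hH, ?_, ?_⟩
  · filter_upwards [self_mem_nhdsWithin, eventually_nhdsWithin_of_eventually_nhds
      (eventually_neg_lt_re hlam)] with s hne hre
    have hne' : s + lam ≠ 0 := fun h => hne (by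
      rw [mem_singleton_iff]; linear_combination h)
    rw [octantMellinExt_eq_ibpTerm hφ hs a b hre, hsplit, ibpTerm_add hφ, ← mul_assoc]
    simp only [Pi.mul_apply]
    congr 1
    rw [ibpFactor, ← Finset.prod_subset (Finset.subset_univ S)
      (fun i _ hi => by simp [hKS' i hi]), ← Finset.prod_const, ← Finset.prod_mul_distrib]
    refine Finset.prod_congr rfl fun i hi => ?_
    have ha' : (a i : ℂ) ≠ 0 := Nat.cast_ne_zero.2 (ha i hi)
    have h := hexp s i
    rw [hKS i hi] at h
    push_cast at h
    rw [hKS i hi, Finset.prod_range_succ, add_assoc (affineExp a b s i), h, mul_inv, sub_neg_eq_add]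
    field_simp
  · have hzero : ∀ i, affineExp a b (-(lam : ℂ)) i + K i = 0 := fun i => by
      rw [hexp, neg_add_cancel, mul_zero]
    have h1 : ibpTerm (mderiv K φ) (a + b)
        (fun i => affineExp a b (-(lam : ℂ)) i + K i) =
          (((-1) ^ S.card * ∫ y, mderiv k φ y ∂Measure.pi (faceMeasure S) : ℝ) : ℂ) := by
      rw [ibpTerm, ← octantMellin_eq_mderiv (contDiff_mderiv hφ K)
        (hasCompactSupport_mderiv hs K) (fun i => by rw [hzero]; simp) (a + b),
        ← integral_mderiv_add_indicator hφ hs S k, ← hK]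
      simp only [octantMellin, cpowProd, hzero, Complex.cpow_zero, Finset.prod_const_one, one_mul]
      exact integral_complex_ofReal
    have h2 : ∀ i ∈ S, (-(a i : ℂ)⁻¹ *
        ∏ ν ∈ Finset.range (k i), -(affineExp a b (-(lam : ℂ)) i + ν + 1)⁻¹) =
          -1 * ((a i : ℂ) * (k i).factorial)⁻¹ := by
      intro i hi
      have h : affineExp a b (-(lam : ℂ)) i = -(k i + 1) := by
        have := hzero i
        rw [hKS i hi] at this
        push_cast at this
        linear_combination this
      have h3 : ∏ ν ∈ Finset.range (k i), -(affineExp a b (-(lam : ℂ)) i + ν + 1)⁻¹ =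
          ((k i).factorial : ℂ)⁻¹ := by
        rw [← Finset.prod_range_add_one_eq_factorial, ← Finset.prod_range_reflect]
        push_cast
        rw [← Finset.prod_inv_distrib]
        refine Finset.prod_congr rfl fun ν hν => ?_
        have hν' := Finset.mem_range.1 hν
        rw [h, ← inv_neg, Nat.cast_sub (by omega), Nat.cast_sub (by omega)]
        push_cast
        ring_nf
      rw [h3, mul_inv]
      ring
    simp only [Pi.mul_apply]
    rw [h1, Finset.prod_congr rfl h2, Finset.prod_mul_distrib, Finset.prod_const]
    push_cast
    have : ((-1 : ℂ) ^ S.card) * (-1) ^ S.card = 1 := by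
      rw [← mul_pow]; norm_num
    linear_combination (∏ i ∈ S, ((a i : ℂ) * (k i).factorial)⁻¹) *
      ((∫ y, mderiv k φ y ∂Measure.pi (faceMeasure S) : ℝ) : ℂ) * this

theorem octantMellin_eq_setIntegral (z : Fin n → ℂ) (φ : (Fin n → ℝ) → ℝ) :
    octantMellin z φ = ∫ y in octant n, cpowProd z y * φ y := by
  have h : octant n = Set.pi univ fun _ => Ici 0 := by ext; simp [octant, Pi.le_def]
  have h' : faceMeasure (∅ : Finset (Fin n)) = fun _ => volume.restrict (Ici 0) :=
    funext fun i => by rw [faceMeasure_empty, restrict_Ioi_eq_restrict_Ici]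
  rw [octantMellin, h, h', volume_pi, Measure.restrict_pi_pi]

open Classical in
theorem integral_faceMeasure {ψ : (Fin n → ℝ) → ℝ} (hψ : Continuous ψ) (S : Finset (Fin n)) :
    ∫ y, ψ y ∂Measure.pi (faceMeasure S) =
      ∫ z : {j // j ∉ S} → ℝ in {z | ∀ j, 0 ≤ z j},
        ψ fun j => if h : j ∈ S then 0 else z ⟨j, h⟩ := by
  have hmp := (measurePreserving_piEquivPiSubtypeProd (faceMeasure S) (· ∈ S)).symm
  have h₁ : (fun j : {j // j ∈ S} => faceMeasure S j) = fun _ => Measure.dirac 0 := by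
    ext1 j; simp [faceMeasure, j.2]
  have h₂ : (fun j : {j // j ∉ S} => faceMeasure S j) = fun _ => volume.restrict (Ici 0) := by
    ext1 j; simp [faceMeasure, j.2, restrict_Ioi_eq_restrict_Ici]
  have h₃ : {z : {j // j ∉ S} → ℝ | ∀ j, 0 ≤ z j} = Set.pi univ fun _ => Ici 0 := by
    ext; simp [Pi.le_def]
  rw [← hmp.integral_comp', h₁, h₂, ← Measure.infinitePi_eq_pi, Measure.infinitePi_dirac,
    Measure.dirac_prod, integral_map (by fun_prop), h₃, volume_pi, Measure.restrict_pi_pi]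
  · rfl
  · exact (hψ.measurable.comp (MeasurableEquiv.measurable _)).aestronglyMeasurable

open Classical in
theorem integral_faceMeasure_insert_last {ψ : (Fin (n + 1) → ℝ) → ℝ} (hψ : Continuous ψ)
    (hs : HasCompactSupport ψ) (Bl : Finset (Fin n)) :
    ∫ y, ψ y ∂Measure.pi (faceMeasure (insert (Fin.last n) (Bl.map Fin.castSuccEmb))) =
      if Bl = Finset.univ then ψ 0
      else ∫ z : {j : Fin n // j ∉ Bl} → ℝ in {z | ∀ j, 0 ≤ z j},
        ψ (fun i => if h : i = Fin.last n then 0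
          else if hj : i.castPred h ∈ Bl then 0 else z ⟨i.castPred h, hj⟩) := by
  have hlast : faceMeasure (insert (Fin.last n) (Bl.map Fin.castSuccEmb)) (Fin.last n) =
      Measure.dirac 0 := by simp [faceMeasure]
  have hcast : (fun j => faceMeasure (insert (Fin.last n) (Bl.map Fin.castSuccEmb))
      ((Fin.last n).succAbove j)) = faceMeasure Bl := by
    ext1 j
    simp [faceMeasure, Fin.castSucc_ne_last]
  rw [integral_pi_insertNth (Fin.last n) (hψ.integrable_of_hasCompactSupport hs), hlast, hcast]
  simp only [integral_dirac]
  rw [integral_faceMeasure (ψ := fun x => ψ ((Fin.last n).insertNth 0 x)) (by fun_prop)]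
  have hext : ∀ z : {j : Fin n // j ∉ Bl} → ℝ,
      ((Fin.last n).insertNth (0 : ℝ) (fun j => if h : j ∈ Bl then 0 else z ⟨j, h⟩) :
        Fin (n + 1) → ℝ) = fun i => if h : i = Fin.last n then 0
          else if hj : i.castPred h ∈ Bl then 0 else z ⟨i.castPred h, hj⟩ := by
    intro z
    ext i
    refine Fin.lastCases ?_ (fun j => ?_) i
    · simp
    · by_cases hj : j ∈ Bl <;> simp [hj, Fin.castSucc_ne_last]
  simp only [hext]
  split_ifs with hBl
  · subst hBl
    have : IsEmpty {j : Fin n // j ∉ Finset.univ} := ⟨fun j => j.2 (Finset.mem_univ _)⟩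
    rw [Measure.volume_pi_eq_dirac]
    have : {z : {j : Fin n // j ∉ Finset.univ} → ℝ | ∀ j, 0 ≤ z j} = univ := by
      ext z; simp
    rw [this, Measure.restrict_univ, integral_dirac]
    congr 1
    ext i
    simp
  · rfl

theorem prod_Icc_sub_eq_factorial (k : ℕ) :
    ∏ ν ∈ Finset.Icc 1 k, ((k : ℝ) + 1 - ν) = k.factorial := by
  rw [← Nat.descFactorial_self, Nat.descFactorial_eq_prod_range, Nat.cast_prod,
    ← Finset.Ico_add_one_right_eq_Icc, Finset.prod_Ico_eq_prod_range]
  refine Finset.prod_congr rfl fun i hi => ?_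
  rw [Nat.cast_sub (by have := Finset.mem_range.1 hi; omega)]
  push_cast
  ring

/-- The slopes of the exponents: `l_j` for `j ∈ Bl`, `1` for the last coordinate, else `0`. -/
def slopeIdx (l : Fin n → ℕ) (Bl : Finset (Fin n)) : Fin (n + 1) → ℕ :=
  Fin.snoc (α := fun _ => ℕ) (fun j => if j ∈ Bl then l j else 0) 1

/-- The constant terms of the exponents: `m_j - 1` for `j ∈ Bl`, else `0`. -/
def offsetIdx (m : Fin n → ℕ) (Bl : Finset (Fin n)) : Fin (n + 1) → ℕ :=
  Fin.snoc (α := fun _ => ℕ) (fun j => if j ∈ Bl then m j - 1 else 0) 0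

@[simp] theorem slopeIdx_last (l : Fin n → ℕ) (Bl : Finset (Fin n)) :
    slopeIdx l Bl (Fin.last n) = 1 := by simp [slopeIdx]

@[simp] theorem slopeIdx_castSucc (l : Fin n → ℕ) (Bl : Finset (Fin n)) (j : Fin n) :
    slopeIdx l Bl j.castSucc = if j ∈ Bl then l j else 0 := by simp [slopeIdx]

@[simp] theorem offsetIdx_last (m : Fin n → ℕ) (Bl : Finset (Fin n)) :
    offsetIdx m Bl (Fin.last n) = 0 := by simp [offsetIdx]

@[simp] theorem offsetIdx_castSucc (m : Fin n → ℕ) (Bl : Finset (Fin n)) (j : Fin n) :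
    offsetIdx m Bl j.castSucc = if j ∈ Bl then m j - 1 else 0 := by simp [offsetIdx]

@[simp] theorem alphaIdx_last (lam : ℕ) (l m : Fin n → ℕ) (Bl : Finset (Fin n)) :
    alphaIdx n lam l m Bl (Fin.last n) = lam - 1 := by simp [alphaIdx]

@[simp] theorem alphaIdx_castSucc (lam : ℕ) (l m : Fin n → ℕ) (Bl : Finset (Fin n)) (j : Fin n) :
    alphaIdx n lam l m Bl j.castSucc = if j ∈ Bl then l j * lam - m j else 0 := by
  by_cases hj : j ∈ Bl <;> simp [alphaIdx, hj, Fin.castSucc_ne_last]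

theorem cpowProd_affineExp (l : Fin n → ℕ) {m : Fin n → ℕ} (hm : ∀ j, 1 ≤ m j)
    (Bl : Finset (Fin n)) (s : ℂ) (y : Fin (n + 1) → ℝ) :
    cpowProd (affineExp (slopeIdx l Bl) (offsetIdx m Bl) s) y =
      (y (Fin.last n) : ℂ) ^ s *
        ∏ j ∈ Bl, (y (Fin.castSucc j) : ℂ) ^ ((l j : ℂ) * s + (m j : ℂ) - 1) := by
  rw [cpowProd, Fin.prod_univ_castSucc, mul_comm,
    ← Finset.prod_subset (Finset.subset_univ Bl)
      (fun j _ hj => by simp [affineExp, hj])]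
  congr 1
  · simp [affineExp]
  · refine Finset.prod_congr rfl fun j hj => ?_
    simp [affineExp, hj, Nat.cast_sub (hm j), add_sub_assoc]

theorem Cval_eq_prod_mul_integral_faceMeasure {φ : (Fin (n + 1) → ℝ) → ℝ}
    (hφ : ContDiff ℝ (⊤ : ℕ∞) φ) (hs : HasCompactSupport φ) (lam : ℕ) (l m : Fin n → ℕ)
    {Bl : Finset (Fin n)} (hBl : ∀ j ∈ Bl, m j ≤ l j * lam) :
    (∏ i ∈ insert (Fin.last n) (Bl.map Fin.castSuccEmb),
        ((slopeIdx l Bl i : ℝ) * (alphaIdx n lam l m Bl i).factorial)⁻¹) *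
      ∫ y, mderiv (alphaIdx n lam l m Bl) φ y
        ∂Measure.pi (faceMeasure (insert (Fin.last n) (Bl.map Fin.castSuccEmb))) =
      Cval n lam l m Bl φ := by
  rw [integral_faceMeasure_insert_last (contDiff_mderiv hφ _).continuous
    (hasCompactSupport_mderiv hs _), Cval, Finset.prod_insert (by simp [Fin.castSucc_ne_last]),
    Finset.prod_map]
  congr 2
  · simp
  · refine Finset.prod_congr rfl fun j hj => ?_
    rw [← prod_Icc_sub_eq_factorial]
    simp [hj, Nat.cast_sub (hBl j hj)]

theorem contDiff_update_neg (i : Fin n) :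
    ContDiff ℝ (⊤ : ℕ∞) fun y : Fin n → ℝ => Function.update y i (-y i) := by
  rw [contDiff_pi]
  intro j
  by_cases h : j = i
  · subst h; simpa using (contDiff_apply ℝ ℝ j).neg
  · simpa [h] using contDiff_apply ℝ ℝ j

theorem hasCompactSupport_comp_update_neg {φ : (Fin n → ℝ) → ℝ} (hs : HasCompactSupport φ)
    (i : Fin n) : HasCompactSupport fun y => φ (Function.update y i (-y i)) :=
  hs.comp_isClosedEmbedding <| Function.LeftInverse.isClosedEmbedding
    (f := fun y => Function.update y i (-y i)) (fun y => by simp)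
    (contDiff_update_neg i).continuous (contDiff_update_neg i).continuous

theorem Cval_comp_update_neg {φ : (Fin (n + 1) → ℝ) → ℝ} (hφ : ContDiff ℝ (⊤ : ℕ∞) φ)
    (lam : ℕ) (l m : Fin n → ℕ) (Bl : Finset (Fin n)) :
    Cval n lam l m Bl (fun y => φ (Function.update y (Fin.last n) (-y (Fin.last n)))) =
      (-1) ^ (lam - 1) * Cval n lam l m Bl φ := by
  have h : ∀ y : Fin (n + 1) → ℝ, y (Fin.last n) = 0 →
      mderiv (alphaIdx n lam l m Bl)
        (fun y => φ (Function.update y (Fin.last n) (-y (Fin.last n)))) y =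
      (-1) ^ (lam - 1) * mderiv (alphaIdx n lam l m Bl) φ y := by
    intro y hy
    rw [mderiv_comp_neg_coord hφ, alphaIdx_last, hy, neg_zero, ← hy, Function.update_eq_self]
  rw [Cval, Cval, h 0 rfl, mul_left_comm]
  congr 1
  rw [mul_ite, ← integral_const_mul]
  congr 2
  ext z
  exact h _ (by simp)

theorem exists_analyticAt_octantMellinExt_Cval {φ : (Fin (n + 1) → ℝ) → ℝ}
    (hφ : ContDiff ℝ (⊤ : ℕ∞) φ) (hs : HasCompactSupport φ) {lam : ℕ} (hlam : 1 ≤ lam)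
    {l m : Fin n → ℕ} (hl : ∀ j, 1 ≤ l j) (hm : ∀ j, 1 ≤ m j) {Bl : Finset (Fin n)}
    (hBl : ∀ j ∈ Bl, m j ≤ l j * lam) :
    ∃ h : ℂ → ℂ, AnalyticAt ℂ h (-(lam : ℂ)) ∧
      (∀ᶠ s in 𝓝[≠] (-(lam : ℂ)), (s - -(lam : ℂ)) ^ (Bl.card + 1) *
        octantMellinExt (slopeIdx l Bl) (offsetIdx m Bl) φ s = h s) ∧
      h (-(lam : ℂ)) = (Cval n lam l m Bl φ : ℝ) := by
  have hcard : (insert (Fin.last n) (Bl.map Fin.castSuccEmb)).card = Bl.card + 1 := by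
    rw [Finset.card_insert_of_notMem (by simp [Fin.castSucc_ne_last]), Finset.card_map]
  rw [← Cval_eq_prod_mul_integral_faceMeasure hφ hs lam l m hBl, ← hcard]
  refine exists_analyticAt_pow_mul_octantMellinExt hφ hs ?_ ?_ ?_
  · refine Fin.lastCases (fun _ => ?_) fun j hj => ?_
    · simp; omega
    · have hj : j ∈ Bl := by simpa [Fin.castSucc_ne_last] using hj
      have := hm j
      have := hBl j hj
      simp [hj]; omega
  · refine Fin.lastCases (fun _ => ?_) fun j hj => ?_
    · simp
    · have hj : j ∈ Bl := by simpa [Fin.castSucc_ne_last] using hj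
      have := hl j
      simp [hj]; omega
  · refine Fin.lastCases (fun h => ?_) fun j hj => ?_
    · simp at h
    · have hj : j ∉ Bl := by simpa [Fin.castSucc_ne_last] using hj
      simp [hj]

/-- The family `s ↦ ∫ y_n^s ∏_{j∈B} y_j^{l_j s + m_j - 1} φ(y) dy` over the octant extends
meromorphically, with a pole of order at most `card B + 1` and leading coefficient `Cval`. -/
theorem exists_meromorphic_extension {φ : (Fin (n + 1) → ℝ) → ℝ}
    (hφ : ContDiff ℝ (⊤ : ℕ∞) φ) (hs : HasCompactSupport φ) {lam : ℕ} (hlam : 1 ≤ lam)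
    {l m : Fin n → ℕ} (hl : ∀ j, 1 ≤ l j) (hm : ∀ j, 1 ≤ m j) {Bl : Finset (Fin n)}
    (hBl : ∀ j ∈ Bl, m j ≤ l j * lam) :
    ∃ G : ℂ → ℂ, MeromorphicOn G univ ∧
      (∀ s : ℂ, 0 < s.re → G s = ∫ y in octant (n + 1),
        ((y (Fin.last n) : ℂ) ^ s *
          ∏ j ∈ Bl, (y (Fin.castSucc j) : ℂ) ^ ((l j : ℂ) * s + (m j : ℂ) - 1)) * (φ y : ℂ)) ∧
      PoleOrderAtMost G (-(lam : ℂ)) (Bl.card + 1) ∧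
      Tendsto (fun s : ℂ => (s + (lam : ℂ)) ^ (Bl.card + 1) * G s)
        (𝓝[≠] (-(lam : ℂ))) (𝓝 (Cval n lam l m Bl φ : ℝ)) := by
  obtain ⟨h, ha, heq, hval⟩ := exists_analyticAt_octantMellinExt_Cval hφ hs hlam hl hm hBl
  refine ⟨octantMellinExt (slopeIdx l Bl) (offsetIdx m Bl) φ,
    meromorphicOn_octantMellinExt hφ hs _ _, fun s hre => ?_, ⟨h, ha, heq⟩, ?_⟩
  · rw [octantMellinExt_eq hφ hs _ _ hre, octantMellin_eq_setIntegral]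
    simp only [cpowProd_affineExp l hm]
  · rw [← hval]
    refine (ha.continuousAt.tendsto.mono_left nhdsWithin_le_nhds).congr' ?_
    filter_upwards [heq] with s hs
    rw [← hs, sub_neg_eq_add]

/-- key computation for Proposition 9.5: the functions
`g_λ^±(s) = ∫_{ℝ₊ⁿ} y_n^s (∏_{j∈B_λ} y_j^{l_j s + m_j - 1}) η(y₁,…,±y_n) dy` extend
meromorphically to `ℂ`, have at `s = -λ` poles of order at most `card B_λ + 1`, and the
leading Laurent coefficients satisfy `b_λ^± = (±1)^{λ-1} C_λ`. -/
theorem statement4 {n : ℕ} (lam : ℕ) (hlam : 1 ≤ lam)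
    (l m : Fin n → ℕ) (hl : ∀ j, 1 ≤ l j) (hm : ∀ j, 1 ≤ m j)
    (η : (Fin (n+1) → ℝ) → ℝ) (hη : ContDiff ℝ (⊤ : ℕ∞) η) (hηs : HasCompactSupport η)
    (Bl : Finset (Fin n)) (hBl : ∀ j, j ∈ Bl ↔ m j ≤ l j * lam) :
    ∃ Gp Gm : ℂ → ℂ,
      MeromorphicOn Gp Set.univ ∧ MeromorphicOn Gm Set.univ ∧
      (∀ s : ℂ, 0 < s.re →
        Gp s = ∫ y in octant (n+1),
            ((y (Fin.last n) : ℂ) ^ s *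
              ∏ j ∈ Bl, (y (Fin.castSucc j) : ℂ) ^ ((l j : ℂ) * s + (m j : ℂ) - 1)) *
            (η y : ℂ) ∧
        Gm s = ∫ y in octant (n+1),
            ((y (Fin.last n) : ℂ) ^ s *
              ∏ j ∈ Bl, (y (Fin.castSucc j) : ℂ) ^ ((l j : ℂ) * s + (m j : ℂ) - 1)) *
            (η (Function.update y (Fin.last n) (-(y (Fin.last n)))) : ℂ)) ∧
      PoleOrderAtMost Gp (-(lam : ℂ)) (Bl.card + 1) ∧
      PoleOrderAtMost Gm (-(lam : ℂ)) (Bl.card + 1) ∧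
      ∃ bp bm : ℂ,
        Tendsto (fun s : ℂ => (s + (lam : ℂ)) ^ (Bl.card + 1) * Gp s)
          (𝓝[≠] (-(lam : ℂ))) (𝓝 bp) ∧
        Tendsto (fun s : ℂ => (s + (lam : ℂ)) ^ (Bl.card + 1) * Gm s)
          (𝓝[≠] (-(lam : ℂ))) (𝓝 bm) ∧
        bp = ((Cval n lam l m Bl η : ℝ) : ℂ) ∧
        bm = ((((-1 : ℝ) ^ (lam - 1)) * Cval n lam l m Bl η : ℝ) : ℂ) ∧
        bp = ((-1 : ℂ)) ^ (lam - 1) * bm := by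
  obtain ⟨Gp, hp, hpint, hppole, hplim⟩ := exists_meromorphic_extension hη hηs hlam hl hm
    fun j hj => (hBl j).1 hj
  obtain ⟨Gm, hmer, hmint, hmpole, hmlim⟩ := exists_meromorphic_extension
    (hη.comp (contDiff_update_neg (Fin.last n)))
    (hasCompactSupport_comp_update_neg hηs (Fin.last n)) hlam hl hm fun j hj => (hBl j).1 hj
  have hC := Cval_comp_update_neg hη lam l m Bl
  refine ⟨Gp, Gm, hp, hmer, fun s hs => ⟨hpint s hs, hmint s hs⟩, hppole, hmpole, _, _,
    hplim, hmlim, rfl, congrArg _ hC, ?_⟩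
  rw [Function.comp_def, hC]
  push_cast
  rw [← mul_assoc, ← mul_pow]
  simp

end KN
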